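/- Let a, b, c, d ∈ ℂ satisfy a² + bc + ad + d² = 0, define τ(ν) = (aν + b)/(cν + d), g^{(0)} ≡ 1, g^{(1)}(ν) = (a + d)²·ν/((aν + b)(cν + d)), g^{(2)}(ν) = (a + d)²·ν/((dν − b)(−cν + a)), and the diagonal matrix k(ν) = diag(τ(ν), ν). Then k solves the 3-reflection equation for the trigonometric r-matrix: for all λ, ν at which all expressions are defined and all relevant matrices are invertible, ∑_{j=0}^{2} g^{(j)}(ν)·k^{(j)}_b(ν)·r(λ,τ^j(ν))·(k^{(j)}_b(ν))^{−1}·k_a(λ) = k_a(λ)·∑_{j=0}^{2} g^{(j)}(ν)·k^{(j)}_b(ν)·r(τ(λ),τ^j(ν))·(k^{(j)}_b(ν))^{−1}. -/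

import Mathlib

open Matrix Kronecker

noncomputable section

/-- `x_a = x ⊗ 1`, acting on `ℂ² ⊗ ℂ²`. -/
def legA (x : Matrix (Fin 2) (Fin 2) ℂ) : Matrix (Fin 2 × Fin 2) (Fin 2 × Fin 2) ℂ :=
  x ⊗ₖ (1 : Matrix (Fin 2) (Fin 2) ℂ)

/-- `x_b = 1 ⊗ x`, acting on `ℂ² ⊗ ℂ²`. -/
def legB (x : Matrix (Fin 2) (Fin 2) ℂ) : Matrix (Fin 2 × Fin 2) (Fin 2 × Fin 2) ℂ :=
  (1 : Matrix (Fin 2) (Fin 2) ℂ) ⊗ₖ x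

/-- `k⁽ʲ⁾(ν) = k⁽ʲ⁻¹⁾(ν) · k(τʲ⁻¹(ν))`, with `k⁽⁰⁾ = 1`. -/
def kiter (k : ℂ → Matrix (Fin 2) (Fin 2) ℂ) (τ : ℂ → ℂ) :
    ℕ → ℂ → Matrix (Fin 2) (Fin 2) ℂ
  | 0, _ => 1
  | j + 1, ν => kiter k τ j ν * k (τ^[j] ν)

/-- The trigonometric `r`-matrix on `ℂ² ⊗ ℂ²` (basis `e₁⊗e₁, e₁⊗e₂, e₂⊗e₁, e₂⊗e₂`). -/
def rtrig (lam ν : ℂ) : Matrix (Fin 2 × Fin 2) (Fin 2 × Fin 2) ℂ :=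
  (2 * (lam - ν))⁻¹ • Matrix.of fun i j =>
    if i = j then (if i.1 = i.2 then -lam - ν else lam + ν)
    else if i = ((0 : Fin 2), (1 : Fin 2)) ∧ j = ((1 : Fin 2), (0 : Fin 2)) then -4 * ν
    else if i = ((1 : Fin 2), (0 : Fin 2)) ∧ j = ((0 : Fin 2), (1 : Fin 2)) then -4 * lam
    else 0

/-- The Möbius map `τ(ν) = (aν + b)/(cν + d)`. -/
def tauM (a b c d ν : ℂ) : ℂ := (a * ν + b) / (c * ν + d)

/-- `g⁽⁰⁾ ≡ 1`, `g⁽¹⁾(ν) = (a+d)²ν/((aν+b)(cν+d))`, `g⁽²⁾(ν) = (a+d)²ν/((dν-b)(-cν+a))`. -/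
def gM (a b c d : ℂ) : ℕ → ℂ → ℂ
  | 0, _ => 1
  | 1, ν => (a + d) ^ 2 * ν / ((a * ν + b) * (c * ν + d))
  | 2, ν => (a + d) ^ 2 * ν / ((d * ν - b) * (-c * ν + a))
  | _ + 3, _ => 0

/-- `k(ν) = diag(τ(ν), ν)`. -/
def kT (a b c d ν : ℂ) : Matrix (Fin 2) (Fin 2) ℂ := Matrix.diagonal ![tauM a b c d ν, ν]

lemma legB_diag_inv (p q : ℂ) (hp : p ≠ 0) (hq : q ≠ 0) :
    (legB (Matrix.diagonal ![p, q]))⁻¹ = legB (Matrix.diagonal ![p⁻¹, q⁻¹]) := by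
  apply Matrix.inv_eq_right_inv
  unfold legB
  rw [← Matrix.mul_kronecker_mul, Matrix.diagonal_mul_diagonal, Matrix.one_mul]
  have : (fun i => ![p, q] i * ![p⁻¹, q⁻¹] i) = fun _ => (1 : ℂ) := by
    funext i
    fin_cases i <;> simp [hp, hq]
  rw [this, Matrix.diagonal_one, Matrix.one_kronecker_one]

/-- The conjugated r-matrix, with off-diagonal entries written out. -/
lemma conj_entries (p q l x : ℂ) (hp : p ≠ 0) (hq : q ≠ 0) :
    legB (Matrix.diagonal ![p, q]) * rtrig l x * (legB (Matrix.diagonal ![p, q]))⁻¹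
      = Matrix.of fun i j =>
    (2 * (l - x))⁻¹ * (if i = j then (if i.1 = i.2 then -l - x else l + x)
    else if i = ((0 : Fin 2), (1 : Fin 2)) ∧ j = ((1 : Fin 2), (0 : Fin 2)) then -4 * x * (q / p)
    else if i = ((1 : Fin 2), (0 : Fin 2)) ∧ j = ((0 : Fin 2), (1 : Fin 2)) then -4 * l * (p / q)
    else 0) := by
  rw [legB_diag_inv p q hp hq]
  unfold legB
  rw [← Matrix.diagonal_one, Matrix.diagonal_kronecker_diagonal,
    Matrix.diagonal_kronecker_diagonal]
  ext ⟨i1, i2⟩ ⟨j1, j2⟩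
  rw [Matrix.mul_diagonal, Matrix.diagonal_mul]
  fin_cases i1 <;> fin_cases i2 <;> fin_cases j1 <;> fin_cases j2 <;>
    simp [rtrig] <;> field_simp

/-- The matrix identity follows from one scalar identity. -/
lemma matrix_of_scalar (l m x0 x1 x2 g1 g2 : ℂ) (h0 : x0 ≠ 0) (hx1 : x1 ≠ 0) (hx2 : x2 ≠ 0)
    (l0 : l - x0 ≠ 0) (l1 : l - x1 ≠ 0) (l2 : l - x2 ≠ 0)
    (m0 : m - x0 ≠ 0) (m1 : m - x1 ≠ 0) (m2 : m - x2 ≠ 0)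
    (key : l * ((l - x0)⁻¹ + g1 * (l - x1)⁻¹ + g2 * (l - x2)⁻¹)
      = m * ((m - x0)⁻¹ + g1 * (m - x1)⁻¹ + g2 * (m - x2)⁻¹)) :
    ((1 : ℂ) • (legB (Matrix.diagonal ![1, 1]) * rtrig l x0 * (legB (Matrix.diagonal ![1, 1]))⁻¹)
      + g1 • (legB (Matrix.diagonal ![x1, x0]) * rtrig l x1
          * (legB (Matrix.diagonal ![x1, x0]))⁻¹)
      + g2 • (legB (Matrix.diagonal ![x1 * x2, x0 * x1]) * rtrig l x2
          * (legB (Matrix.diagonal ![x1 * x2, x0 * x1]))⁻¹)) * legA (Matrix.diagonal ![m, l])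
    = legA (Matrix.diagonal ![m, l]) *
     ((1 : ℂ) • (legB (Matrix.diagonal ![1, 1]) * rtrig m x0 * (legB (Matrix.diagonal ![1, 1]))⁻¹)
      + g1 • (legB (Matrix.diagonal ![x1, x0]) * rtrig m x1
          * (legB (Matrix.diagonal ![x1, x0]))⁻¹)
      + g2 • (legB (Matrix.diagonal ![x1 * x2, x0 * x1]) * rtrig m x2
          * (legB (Matrix.diagonal ![x1 * x2, x0 * x1]))⁻¹)) := by
  have e1 : (1 : ℂ) ≠ 0 := one_ne_zero
  rw [conj_entries _ _ _ _ e1 e1, conj_entries _ _ _ _ hx1 h0,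
    conj_entries _ _ _ _ (mul_ne_zero hx1 hx2) (mul_ne_zero h0 hx1),
    conj_entries _ _ _ _ e1 e1, conj_entries _ _ _ _ hx1 h0,
    conj_entries _ _ _ _ (mul_ne_zero hx1 hx2) (mul_ne_zero h0 hx1)]
  have r0 := mul_inv_cancel₀ l0
  have r1 := mul_inv_cancel₀ l1
  have r2 := mul_inv_cancel₀ l2
  have s0 := mul_inv_cancel₀ m0
  have s1 := mul_inv_cancel₀ m1
  have s2 := mul_inv_cancel₀ m2
  have q2 : x0 * x1 / (x1 * x2) = x0 / x2 := by field_simp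
  have q2' : x1 * x2 / (x0 * x1) = x2 / x0 := by field_simp
  rw [q2, q2']
  have t1 : x1 * (x0 / x1) = x0 := by field_simp
  have t2 : x2 * (x0 / x2) = x0 := by field_simp
  have t3 : x0 * x0⁻¹ = 1 := mul_inv_cancel₀ h0
  unfold legA
  rw [← Matrix.diagonal_one, Matrix.diagonal_kronecker_diagonal]
  simp only [mul_inv, div_eq_mul_inv] at *
  generalize (l - x0)⁻¹ = L0 at *
  generalize (l - x1)⁻¹ = L1 at *
  generalize (l - x2)⁻¹ = L2 at *
  generalize (m - x0)⁻¹ = M0 at *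
  generalize (m - x1)⁻¹ = M1 at *
  generalize (m - x2)⁻¹ = M2 at *
  ext ⟨i1, i2⟩ ⟨j1, j2⟩
  rw [Matrix.mul_diagonal, Matrix.diagonal_mul]
  fin_cases i1 <;> fin_cases i2 <;> fin_cases j1 <;> fin_cases j2 <;> simp
  · linear_combination (-m) * key + (m/2) * (r0 + g1 * r1 + g2 * r2 - s0 - g1 * s1 - g2 * s2)
  · linear_combination (m) * key - (m/2) * (r0 + g1 * r1 + g2 * r2 - s0 - g1 * s1 - g2 * s2)
  · linear_combination (-2 * x0) * key - 2 * g1 * (L1 * l - M1 * m) * t1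
      - 2 * g2 * (L2 * l - M2 * m) * t2
  · linear_combination (-2 * l * m * x0⁻¹) * key
      + 2 * l * m * x0⁻¹ * (r0 + g1 * r1 + g2 * r2 - s0 - g1 * s1 - g2 * s2)
      + 2 * l * m * (L0 - M0) * t3
  · linear_combination (l) * key - (l/2) * (r0 + g1 * r1 + g2 * r2 - s0 - g1 * s1 - g2 * s2)
  · linear_combination (-l) * key + (l/2) * (r0 + g1 * r1 + g2 * r2 - s0 - g1 * s1 - g2 * s2)

/-- The scalar identity, after clearing the inner denominators. -/
lemma scalar_core (a b c d l v : ℂ) (hc : a ^ 2 + b * c + a * d + d ^ 2 = 0)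
    (hn1 : a * v + b ≠ 0) (hn2 : d * v - b ≠ 0) (h0 : l - v ≠ 0)
    (hD1 : l * (c * v + d) - (a * v + b) ≠ 0) (hD2 : l * (-c * v + a) - (d * v - b) ≠ 0) :
    l / (l - v) + (a + d) ^ 2 * v * l / ((a * v + b) * (l * (c * v + d) - (a * v + b)))
      + (a + d) ^ 2 * v * l / ((d * v - b) * (l * (-c * v + a) - (d * v - b)))
    = (a * l + b) / (l * (-c * v + a) - (d * v - b))
      + v * (a * l + b) / ((a * v + b) * (l - v))
      - (a + d) * v * (a * l + b) / ((d * v - b) * (l * (c * v + d) - (a * v + b))) := by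
  have e0 : l / (l - v) - v * (a * l + b) / ((a * v + b) * (l - v)) = b / (a * v + b) := by
    rw [div_sub_div _ _ h0 (mul_ne_zero hn1 h0), div_eq_div_iff (by positivity) hn1]
    ring
  have e1 : (a + d) ^ 2 * v * l / ((a * v + b) * (l * (c * v + d) - (a * v + b)))
      + (a + d) * v * (a * l + b) / ((d * v - b) * (l * (c * v + d) - (a * v + b)))
      = - ((a + d) * v * b) / ((a * v + b) * (d * v - b)) := by
    generalize hD : l * (c * v + d) - (a * v + b) = D at *
    rw [div_add_div _ _ (mul_ne_zero hn1 hD1) (mul_ne_zero hn2 hD1),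
      div_eq_div_iff (by positivity) (by positivity)]
    have : (a + d) * l * (d * v - b) + (a * l + b) * (a * v + b) + b * D = 0 := by
      linear_combination (-b) * hD + l * v * hc
    linear_combination (a + d) * v * (a * v + b) * (d * v - b) * D * this
  have e2 : (a + d) ^ 2 * v * l / ((d * v - b) * (l * (-c * v + a) - (d * v - b)))
      - (a * l + b) / (l * (-c * v + a) - (d * v - b)) = b / (d * v - b) := by
    generalize hD : l * (-c * v + a) - (d * v - b) = D at *
    rw [div_sub_div _ _ (mul_ne_zero hn2 hD2) hD2,
      div_eq_div_iff (by positivity) (by positivity)]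
    have : (a + d) ^ 2 * v * l - (a * l + b) * (d * v - b) - b * D = 0 := by
      linear_combination b * hD + l * v * hc
    linear_combination (d * v - b) * D * this
  have e3 : b / (a * v + b) + - ((a + d) * v * b) / ((a * v + b) * (d * v - b))
      + b / (d * v - b) = 0 := by
    rw [div_add_div _ _ hn1 (mul_ne_zero hn1 hn2),
      div_add_div _ _ (mul_ne_zero hn1 (mul_ne_zero hn1 hn2)) hn2, div_eq_zero_iff]
    left
    ring
  linear_combination e0 + e1 + e2 + e3

/-- The diagonal matrix `k(ν) = diag(τ(ν), ν)` solves the 3-reflection equation for the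
trigonometric `r`-matrix with `τ(ν) = (aν+b)/(cν+d)`, `a² + bc + ad + d² = 0`. -/
theorem stmt14 (a b c d : ℂ) (hconstr : a ^ 2 + b * c + a * d + d ^ 2 = 0)
    (lam ν : ℂ)
    (h1 : lam ≠ ν) (h2 : lam ≠ tauM a b c d ν) (h3 : lam ≠ tauM a b c d (tauM a b c d ν))
    (h4 : tauM a b c d lam ≠ ν) (h5 : tauM a b c d lam ≠ tauM a b c d ν)
    (h6 : tauM a b c d lam ≠ tauM a b c d (tauM a b c d ν))
    (h7 : c * ν + d ≠ 0) (h8 : c * lam + d ≠ 0) (h9 : c * tauM a b c d ν + d ≠ 0)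
    (h10 : a * ν + b ≠ 0) (h11 : d * ν - b ≠ 0) (h12 : -c * ν + a ≠ 0)
    (h13 : IsUnit (kT a b c d ν)) (h14 : IsUnit (kT a b c d (tauM a b c d ν))) :
    (∑ j ∈ Finset.range 3, gM a b c d j ν •
        (legB (kiter (kT a b c d) (tauM a b c d) j ν) * rtrig lam ((tauM a b c d)^[j] ν)
          * (legB (kiter (kT a b c d) (tauM a b c d) j ν))⁻¹)) * legA (kT a b c d lam)
      = legA (kT a b c d lam) *
        ∑ j ∈ Finset.range 3, gM a b c d j ν •
          (legB (kiter (kT a b c d) (tauM a b c d) j ν)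
            * rtrig (tauM a b c d lam) ((tauM a b c d)^[j] ν)
            * (legB (kiter (kT a b c d) (tauM a b c d) j ν))⁻¹) := by
  have hs : a + d ≠ 0 := by
    intro hs
    apply h5
    unfold tauM
    rw [div_eq_div_iff h8 h7]
    linear_combination (lam - ν) * ((a + d) * hs - hconstr)
  have hx2 : tauM a b c d (tauM a b c d ν) = (d * ν - b) / (-c * ν + a) := by
    have hN : a * tauM a b c d ν + b = -(a + d) * (d * ν - b) / (c * ν + d) := by
      unfold tauM
      rw [eq_div_iff h7, add_mul, mul_assoc, div_mul_cancel₀ _ h7]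
      linear_combination ν * hconstr
    have hE : c * tauM a b c d ν + d = -(a + d) * (-c * ν + a) / (c * ν + d) := by
      unfold tauM
      rw [eq_div_iff h7, add_mul, mul_assoc, div_mul_cancel₀ _ h7]
      linear_combination hconstr
    change (a * tauM a b c d ν + b) / (c * tauM a b c d ν + d) = _
    rw [hN, hE, div_div_div_cancel_right₀ h7, mul_div_mul_left _ _ (neg_ne_zero.mpr hs)]
  have hx1 : tauM a b c d ν = (a * ν + b) / (c * ν + d) := rfl
  have hm : tauM a b c d lam = (a * lam + b) / (c * lam + d) := rfl
  have x1ne : tauM a b c d ν ≠ 0 := div_ne_zero h10 h7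
  have x2ne : tauM a b c d (tauM a b c d ν) ≠ 0 := by
    rw [hx2]
    exact div_ne_zero h11 h12
  have x0ne : ν ≠ 0 := by
    rintro rfl
    rw [Matrix.isUnit_iff_isUnit_det] at h13
    simp [kT] at h13
  have l0 := sub_ne_zero.mpr h1
  have l1 := sub_ne_zero.mpr h2
  have l2 := sub_ne_zero.mpr h3
  have m0 := sub_ne_zero.mpr h4
  have m1 := sub_ne_zero.mpr h5
  have m2 := sub_ne_zero.mpr h6
  have L1 : lam - tauM a b c d ν = (lam * (c * ν + d) - (a * ν + b)) / (c * ν + d) := by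
    rw [hx1, eq_div_iff h7, sub_mul, div_mul_cancel₀ _ h7]
  have L2 : lam - tauM a b c d (tauM a b c d ν)
      = (lam * (-c * ν + a) - (d * ν - b)) / (-c * ν + a) := by
    rw [hx2, eq_div_iff h12, sub_mul, div_mul_cancel₀ _ h12]
  have M0 : tauM a b c d lam - ν
      = (lam * (-c * ν + a) - (d * ν - b)) / (c * lam + d) := by
    rw [hm, eq_div_iff h8, sub_mul, div_mul_cancel₀ _ h8]; ring
  have M1 : tauM a b c d lam - tauM a b c d ν
      = (a + d) ^ 2 * (lam - ν) / ((c * lam + d) * (c * ν + d)) := by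
    rw [hm, hx1, div_sub_div _ _ h8 h7]
    congr 1
    linear_combination (ν - lam) * hconstr
  have M2 : tauM a b c d lam - tauM a b c d (tauM a b c d ν)
      = - ((a + d) * (lam * (c * ν + d) - (a * ν + b))) / ((c * lam + d) * (-c * ν + a)) := by
    rw [hm, hx2, div_sub_div _ _ h8 h12]
    congr 1
    linear_combination (lam - ν) * hconstr
  have hD1 : lam * (c * ν + d) - (a * ν + b) ≠ 0 := by
    intro h
    rw [L1, h, zero_div] at l1
    exact l1 rfl
  have hD2 : lam * (-c * ν + a) - (d * ν - b) ≠ 0 := by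
    intro h
    rw [L2, h, zero_div] at l2
    exact l2 rfl
  have core := scalar_core a b c d lam ν hconstr h10 h11 l0 hD1 hD2
  have key : lam * ((lam - ν)⁻¹ + gM a b c d 1 ν * (lam - tauM a b c d ν)⁻¹
        + gM a b c d 2 ν * (lam - tauM a b c d (tauM a b c d ν))⁻¹)
      = tauM a b c d lam * ((tauM a b c d lam - ν)⁻¹
        + gM a b c d 1 ν * (tauM a b c d lam - tauM a b c d ν)⁻¹
        + gM a b c d 2 ν * (tauM a b c d lam - tauM a b c d (tauM a b c d ν))⁻¹) := by
    rw [L1, L2, M0, M1, M2, hm]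
    simp only [gM]
    generalize lam * (c * ν + d) - (a * ν + b) = D1 at *
    generalize lam * (-c * ν + a) - (d * ν - b) = D2 at *
    generalize lam - ν = D0 at *
    generalize a * ν + b = n1 at *
    generalize d * ν - b = n2 at *
    generalize c * ν + d = d1 at *
    generalize -c * ν + a = d2 at *
    generalize c * lam + d = E at *
    generalize a * lam + b = N at *
    generalize a + d = s at *
    trans (lam / D0 + s ^ 2 * ν * lam / (n1 * D1) + s ^ 2 * ν * lam / (n2 * D2))
    · field_simp
    · rw [core]
      field_simp
      try ring
  have M := matrix_of_scalar lam (tauM a b c d lam) ν (tauM a b c d ν)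
    (tauM a b c d (tauM a b c d ν)) (gM a b c d 1 ν) (gM a b c d 2 ν) x0ne x1ne x2ne
    l0 l1 l2 m0 m1 m2 key
  have k0 : kiter (kT a b c d) (tauM a b c d) 0 ν = Matrix.diagonal ![1, 1] := by
    ext i j
    fin_cases i <;> fin_cases j <;> simp [kiter]
  have k1 : kiter (kT a b c d) (tauM a b c d) 1 ν = Matrix.diagonal ![tauM a b c d ν, ν] := by
    simp [kiter, kT]
  have k2 : kiter (kT a b c d) (tauM a b c d) 2 ν
      = Matrix.diagonal ![tauM a b c d ν * tauM a b c d (tauM a b c d ν),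
          ν * tauM a b c d ν] := by
    ext i j
    fin_cases i <;> fin_cases j <;> simp [kiter, kT]
  have g0 : gM a b c d 0 ν = 1 := rfl
  simp only [Finset.sum_range_succ, Finset.sum_range_zero, zero_add, k0, k1, k2, g0]
  exact M
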